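/- arXiv:2108.09406 — 2 statements merged into one kernel-verified Lean document; each statement's English description precedes it below -/
import Mathlib

section
/- Let ψ(t) := Φ_A(t)ᵀC(t) and W(0,T) := ∫₀ᵀ ψ(τ)ψ(τ)ᵀ dτ. If there exist time instants 0 ≤ t₁ ≤ … ≤ tₙ such that the matrix with columns ψ(t₁), …, ψ(tₙ) has rank n, then for every T > tₙ the Gramian W(0,T) is positive definite, i.e. vᵀW(0,T)v > 0 for every nonzero v ∈ ℝⁿ. -/
open Matrix

/-- Observability Gramian `W(0,T) = ∫₀ᵀ ψ(τ)ψ(τ)ᵀ dτ` (entrywise). -/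
noncomputable def obsGram (n : ℕ) (ψ : ℝ → Fin n → ℝ) (T : ℝ) :
    Matrix (Fin n) (Fin n) ℝ :=
  Matrix.of fun i j => ∫ τ in (0:ℝ)..T, ψ τ i * ψ τ j

/-- Sample matrix whose `j`-th column is `ψ (t j)`. -/
def sampleMatrix (n : ℕ) (ψ : ℝ → Fin n → ℝ) (t : Fin n → ℝ) :
    Matrix (Fin n) (Fin n) ℝ :=
  Matrix.of fun i j => ψ (t j) i

theorem continuous_transpose_mulVec {n : ℕ} {C : ℝ → Fin n → ℝ} (hC : Continuous C)
    {Φ : ℝ → Matrix (Fin n) (Fin n) ℝ} (hΦ : Continuous Φ) :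
    Continuous fun s => (Φ s)ᵀ *ᵥ C s :=
  hΦ.matrix_transpose.matrix_mulVec hC

/-- The quadratic form of the Gramian is the energy of the output `v ⬝ᵥ ψ`. -/
theorem dotProduct_obsGram_mulVec {n : ℕ} {ψ : ℝ → Fin n → ℝ} (hψ : Continuous ψ) (T : ℝ)
    (v : Fin n → ℝ) :
    v ⬝ᵥ (obsGram n ψ T *ᵥ v) = ∫ τ in (0 : ℝ)..T, (v ⬝ᵥ ψ τ) ^ 2 := by
  have hcont (i : Fin n) : Continuous fun τ => ψ τ i := (continuous_apply i).comp hψ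
  have hterm (i j : Fin n) : Continuous fun τ => v i * (ψ τ i * ψ τ j * v j) :=
    continuous_const.mul (((hcont i).mul (hcont j)).mul continuous_const)
  have hsq (τ : ℝ) : (v ⬝ᵥ ψ τ) ^ 2 = ∑ i, ∑ j, v i * (ψ τ i * ψ τ j * v j) := by
    simp only [dotProduct, sq, Finset.sum_mul_sum]
    exact Finset.sum_congr rfl fun i _ => Finset.sum_congr rfl fun j _ => by ring
  simp only [hsq]
  rw [intervalIntegral.integral_finsetSum fun i _ =>
    (continuous_finsetSum _ fun j _ => hterm i j).intervalIntegrable 0 T]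
  refine Finset.sum_congr rfl fun i _ => ?_
  rw [intervalIntegral.integral_finsetSum fun j _ =>
    (hterm i j).intervalIntegrable 0 T]
  simp [mulVec, dotProduct, obsGram, Finset.mul_sum]

/-- If the samples of `ψ` span, no nonzero vector is orthogonal to all of them. -/
theorem exists_dotProduct_ne_zero_of_rank_sampleMatrix {n : ℕ} {ψ : ℝ → Fin n → ℝ}
    {t : Fin n → ℝ} (hrank : (sampleMatrix n ψ t).rank = n) {v : Fin n → ℝ} (hv : v ≠ 0) :
    ∃ i, v ⬝ᵥ ψ (t i) ≠ 0 := by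
  by_contra! h
  have hrows : LinearIndependent ℝ (sampleMatrix n ψ t).row := by
    rw [linearIndependent_iff_card_eq_finrank_span, Set.finrank, ← rank_eq_finrank_span_row,
      hrank, Fintype.card_fin]
  refine hv (vecMul_injective_iff.mpr hrows ?_)
  simp only [zero_vecMul]
  exact funext h

/-- If there exist times `0 ≤ t₁ ≤ … ≤ tₙ` making the sample matrix full rank, then
for every `T > tₙ` the Gramian `W(0,T)` is positive definite. -/
theorem identifiability_implies_gramian_posdef (n : ℕ) (hn : 1 ≤ n)
    (C : ℝ → Fin n → ℝ) (hC : Continuous C)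
    (Φ : ℝ → Matrix (Fin n) (Fin n) ℝ) (hΦ : Continuous Φ)
    (ψ : ℝ → Fin n → ℝ) (hψ : ∀ s, ψ s = (Φ s)ᵀ *ᵥ C s)
    (t : Fin n → ℝ) (ht0 : ∀ i, 0 ≤ t i) (htmono : Monotone t)
    (hrank : (sampleMatrix n ψ t).rank = n) :
    ∀ T : ℝ, (∀ i, t i < T) →
      ∀ v : Fin n → ℝ, v ≠ 0 → 0 < v ⬝ᵥ (obsGram n ψ T *ᵥ v) := by
  intro T hT v hv
  have hcont : Continuous ψ := by
    rw [funext hψ]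
    exact continuous_transpose_mulVec hC hΦ
  obtain ⟨i, hi⟩ := exists_dotProduct_ne_zero_of_rank_sampleMatrix hrank hv
  rw [dotProduct_obsGram_mulVec hcont]
  have hsq : Continuous fun τ => (v ⬝ᵥ ψ τ) ^ 2 := (continuous_const.dotProduct hcont).pow 2
  exact intervalIntegral.integral_pos ((ht0 i).trans_lt (hT i)) hsq.continuousOn
    (fun _ _ => sq_nonneg _) ⟨t i, ⟨ht0 i, (hT i).le⟩, by positivity⟩
end

section
/- (G+D estimator convergence.) Let 𝒴(t) = ψ(t)ᵀθ with θ ∈ ℝⁿ constant and ψ continuous, and consider the interlaced estimator: θ̂_g'(t) = γ_g ψ(t)(𝒴(t) − ψ(t)ᵀθ̂_g(t)), θ̂_g(0) = θ_{g0}; Ω'(t) = −γ_g ψ(t)ψ(t)ᵀ Ω(t), Ω(0) = Iₙ; Δ(t) := det(Iₙ − Ω(t)); Y(t) := adj(Iₙ − Ω(t))(θ̂_g(t) − Ω(t)θ_{g0}); θ̂'(t) = γ Δ(t)(Y(t) − Δ(t)θ̂(t)), θ̂(0) = θ₀, with γ_g, γ > 0. If ψ is interval exciting — there exist t_d > 0,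 C_d > 0 with ∫₀^{t_d} ψ(s)ψ(s)ᵀ ds ≥ C_d Iₙ — then there exist constants c > 0 and λ > 0 such that |θ̂(t) − θ| ≤ c e^{−λ t} for all t ≥ 0, and the trajectories θ̂_g(t), Ω(t), θ̂(t) are bounded on [0,∞). -/
open Matrix

/-- Derivative of the squared Euclidean length of a curve. -/
theorem HasDerivAt.dotProduct_self {n : ℕ} {x : ℝ → Fin n → ℝ} {x' : Fin n → ℝ} {t : ℝ}
    (h : HasDerivAt x x' t) :
    HasDerivAt (fun s => x s ⬝ᵥ x s) (2 * (x t ⬝ᵥ x')) t := by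
  have hi := hasDerivAt_pi.1 h
  refine (HasDerivAt.fun_sum (u := Finset.univ) fun i _ => (hi i).mul (hi i)).congr_deriv ?_
  simp only [dotProduct, Finset.mul_sum]
  exact Finset.sum_congr rfl fun i _ => by ring

/-- Solutions of the gradient flow `z' = -g (ψᵀz) ψ` have nonincreasing length. -/
theorem antitone_dotProduct_self_of_gradient_flow {n : ℕ} {g : ℝ} (hg : 0 < g)
    {ψ z : ℝ → Fin n → ℝ} (hz : ∀ t, HasDerivAt z ((-g * (ψ t ⬝ᵥ z t)) • ψ t) t) :
    Antitone fun t => z t ⬝ᵥ z t := by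
  refine antitone_of_hasDerivAt_nonpos (fun t => (hz t).dotProduct_self) fun t => ?_
  rw [dotProduct_smul, smul_eq_mul, dotProduct_comm (z t), Pi.zero_apply]
  nlinarith [mul_nonneg hg.le (sq_nonneg (ψ t ⬝ᵥ z t))]

/-- If a gradient flow does not lose length on `[0, T]`, its initial value is orthogonal to the
regressor there. -/
theorem dotProduct_eq_zero_of_gradient_flow {n : ℕ} {g T : ℝ} (hg : 0 < g)
    {ψ z : ℝ → Fin n → ℝ} (hz : ∀ t, HasDerivAt z ((-g * (ψ t ⬝ᵥ z t)) • ψ t) t)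
    (hT : z 0 ⬝ᵥ z 0 ≤ z T ⬝ᵥ z T) : ∀ t ∈ Set.Ico 0 T, ψ t ⬝ᵥ z 0 = 0 := by
  have hanti := antitone_dotProduct_self_of_gradient_flow hg hz
  have hconst : ∀ t ∈ Set.Icc 0 T, z t ⬝ᵥ z t = z 0 ⬝ᵥ z 0 := fun t ht =>
    le_antisymm (hanti ht.1) (hT.trans (hanti ht.2))
  have horth : ∀ t ∈ Set.Ico 0 T, ψ t ⬝ᵥ z t = 0 := by
    intro t ht
    have h0 : HasDerivWithinAt (fun s => z s ⬝ᵥ z s) 0 (Set.Ici t) t := by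
      refine (hasDerivWithinAt_const t (Set.Ici t) (z 0 ⬝ᵥ z 0)).congr_of_eventuallyEq ?_
        (hconst t ⟨ht.1, ht.2.le⟩)
      filter_upwards [Icc_mem_nhdsGE ht.2] with s hs
      exact hconst s ⟨ht.1.trans hs.1, hs.2⟩
    have h := (uniqueDiffWithinAt_Ici t).eq_deriv _ h0 (hz t).dotProduct_self.hasDerivWithinAt
    rw [dotProduct_smul, smul_eq_mul, dotProduct_comm (z t)] at h
    have h' : g * (ψ t ⬝ᵥ z t) ^ 2 = 0 := by linarith
    simpa [hg.ne'] using h'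
  intro t ht
  have hzt : z t = z 0 :=
    constant_of_has_deriv_right_zero (fun s _ => (hz s).continuousAt.continuousWithinAt)
      (fun s hs => by simpa [horth s hs] using (hz s).hasDerivWithinAt (s := Set.Ici s))
      t ⟨ht.1, ht.2.le⟩
  rw [← hzt]
  exact horth t ht

theorem obsGram_mulVec_eq_zero {n : ℕ} {ψ : ℝ → Fin n → ℝ} (hψ : Continuous ψ) {T : ℝ}
    (hT : 0 < T) {v : Fin n → ℝ} (hv : ∀ t ∈ Set.Ico 0 T, ψ t ⬝ᵥ v = 0) :
    obsGram n ψ T *ᵥ v = 0 := by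
  have hc : ∀ i, Continuous fun t => ψ t i := fun i => (continuous_apply i).comp hψ
  have hv' : ∀ t ∈ Set.Icc 0 T, ψ t ⬝ᵥ v = 0 := by
    have hcl : IsClosed {t | ψ t ⬝ᵥ v = 0} :=
      isClosed_eq (hψ.dotProduct continuous_const) continuous_const
    rw [← closure_Ico hT.ne]
    exact hcl.closure_subset_iff.2 hv
  ext i
  have hint : ∀ j ∈ Finset.univ, IntervalIntegrable (fun t => ψ t i * ψ t j * v j)
      MeasureTheory.volume 0 T := fun j _ =>
    (((hc i).mul (hc j)).mul continuous_const).intervalIntegrable _ _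
  simp only [obsGram, mulVec, dotProduct, of_apply, Pi.zero_apply,
    ← intervalIntegral.integral_mul_const]
  rw [← intervalIntegral.integral_finsetSum hint]
  refine (intervalIntegral.integral_congr fun t ht => ?_).trans intervalIntegral.integral_zero
  rw [Set.uIcc_of_le hT.le] at ht
  have := hv' t ht
  simp only [dotProduct] at this
  simp only [mul_assoc, ← Finset.mul_sum, this, mul_zero]

theorem dotProduct_self_nonneg_real {n : ℕ} (x : Fin n → ℝ) : 0 ≤ x ⬝ᵥ x :=
  Finset.sum_nonneg fun i _ => mul_self_nonneg (x i)

theorem dotProduct_self_le_of_sub {n : ℕ} (x y : Fin n → ℝ) :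
    x ⬝ᵥ x ≤ 2 * ((x - y) ⬝ᵥ (x - y)) + 2 * (y ⬝ᵥ y) := by
  simp only [dotProduct, Finset.mul_sum, ← Finset.sum_add_distrib, Pi.sub_apply]
  exact Finset.sum_le_sum fun i _ => by nlinarith [sq_nonneg (x i - 2 * y i)]

theorem sq_apply_le_of_mulVec_single {n : ℕ} (A : Matrix (Fin n) (Fin n) ℝ) (i j : Fin n) :
    A i j ^ 2 ≤ (A *ᵥ Pi.single j 1) ⬝ᵥ (A *ᵥ Pi.single j 1) := by
  simp only [mulVec_single_one, dotProduct, col_apply, sq]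
  exact Finset.single_le_sum (f := fun i => A i j * A i j)
    (fun i _ => mul_self_nonneg _) (Finset.mem_univ i)

/-- If `B` does not fix or expand any nonzero vector, then `det (1 - A)` is bounded away from zero
over all `A` dominated by `B`. -/
theorem exists_pos_le_det_one_sub_sq {n : ℕ} (B : Matrix (Fin n) (Fin n) ℝ)
    (hB : ∀ v : Fin n → ℝ, v ⬝ᵥ v ≤ (B *ᵥ v) ⬝ᵥ (B *ᵥ v) → v = 0) :
    ∃ d > (0 : ℝ), ∀ A : Matrix (Fin n) (Fin n) ℝ,
      (∀ v, (A *ᵥ v) ⬝ᵥ (A *ᵥ v) ≤ (B *ᵥ v) ⬝ᵥ (B *ᵥ v)) → d ≤ (1 - A).det ^ 2 := by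
  set K : Set (Matrix (Fin n) (Fin n) ℝ) :=
    {A | ∀ v, (A *ᵥ v) ⬝ᵥ (A *ᵥ v) ≤ (B *ᵥ v) ⬝ᵥ (B *ᵥ v)} with hK
  have hclosed : IsClosed K := by
    simp only [hK, Set.ofPred_forall]
    refine isClosed_iInter fun v => isClosed_le ?_ continuous_const
    have h : Continuous fun A : Matrix (Fin n) (Fin n) ℝ => A *ᵥ v :=
      continuous_id.matrix_mulVec continuous_const
    exact h.dotProduct h
  set R : Fin n → ℝ := fun j => √((B *ᵥ Pi.single j 1) ⬝ᵥ (B *ᵥ Pi.single j 1))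
  have hbox : IsCompact (Set.univ.pi fun _ : Fin n => Set.univ.pi fun j : Fin n =>
      Set.Icc (-R j) (R j)) :=
    isCompact_univ_pi fun _ => isCompact_univ_pi fun _ => isCompact_Icc
  have hcompact : IsCompact K := by
    refine IsCompact.of_isClosed_subset hbox hclosed fun A hA i _ j _ => ?_
    exact abs_le.1 (Real.abs_le_sqrt ((sq_apply_le_of_mulVec_single A i j).trans (hA _)))
  have hdet : Continuous fun A : Matrix (Fin n) (Fin n) ℝ => (1 - A).det ^ 2 :=
    ((continuous_const.sub continuous_id).matrix_det).pow 2
  obtain ⟨A₀, hA₀, hmin⟩ := hcompact.exists_isMinOn ⟨B, fun _ => le_rfl⟩ hdet.continuousOn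
  refine ⟨(1 - A₀).det ^ 2, ?_, fun A hA => hmin hA⟩
  refine sq_pos_of_ne_zero ?_
  intro h0
  obtain ⟨v, hv, hv0⟩ := exists_mulVec_eq_zero_iff.2 h0
  rw [sub_mulVec, one_mulVec, sub_eq_zero] at hv0
  refine hv (hB v ?_)
  have := hA₀ v
  rwa [← hv0] at this

/-- A nonnegative quantity with `W' = -a W`, `a ≥ 0` on `[0, ∞)` and `a ≥ k` on `[T, ∞)`, decays
exponentially at rate `k`. -/
theorem le_mul_exp_of_hasDerivAt {W a : ℝ → ℝ} {k T : ℝ} (hT : 0 ≤ T) (hk : 0 ≤ k)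
    (hW : ∀ t, 0 ≤ W t) (hd : ∀ t, 0 ≤ t → HasDerivAt W (-a t * W t) t)
    (ha : ∀ t, 0 ≤ a t) (hak : ∀ t, T ≤ t → k ≤ a t) :
    ∀ t, 0 ≤ t → W t ≤ W 0 * Real.exp (k * (T - t)) := by
  have hWc : ContinuousOn W (Set.Ici 0) := fun t ht => (hd t ht).continuousAt.continuousWithinAt
  have hanti : AntitoneOn W (Set.Ici 0) := by
    refine antitoneOn_of_hasDerivWithinAt_nonpos (f' := fun t => -a t * W t)
      (convex_Ici 0) hWc (fun t ht => ?_) fun t ht => ?_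
    · exact (hd t (interior_subset ht)).hasDerivWithinAt
    · nlinarith [mul_nonneg (ha t) (hW t)]
  have hexp : ∀ t : ℝ, HasDerivAt (fun s => Real.exp (k * (s - T)))
      (Real.exp (k * (t - T)) * (k * 1)) t := fun t =>
    (((hasDerivAt_id t).sub_const T).const_mul k).exp
  have hanti' : AntitoneOn (fun t => W t * Real.exp (k * (t - T))) (Set.Ici T) := by
    have hdt : ∀ t ∈ Set.Ici T, HasDerivAt (fun t => W t * Real.exp (k * (t - T)))
        (-a t * W t * Real.exp (k * (t - T)) + W t * (Real.exp (k * (t - T)) * (k * 1))) t :=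
      fun t ht => (hd t (hT.trans ht)).mul (hexp t)
    refine antitoneOn_of_hasDerivWithinAt_nonpos (convex_Ici T)
      (fun t ht => (hdt t ht).continuousAt.continuousWithinAt)
      (fun t ht => (hdt t (interior_subset ht)).hasDerivWithinAt) fun t ht => ?_
    have h1 := hak t (interior_subset ht)
    have h2 := mul_nonneg (hW t) (Real.exp_pos (k * (t - T))).le
    nlinarith [mul_nonneg (sub_nonneg.2 h1) h2]
  intro t ht
  rcases le_total T t with h | h
  · have h1 := hanti' (Set.mem_Ici.2 le_rfl) h h
    simp only [sub_self, mul_zero, Real.exp_zero, mul_one] at h1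
    have h2 : W t * Real.exp (k * (t - T)) ≤ W 0 := h1.trans (hanti (Set.mem_Ici.2 le_rfl) hT hT)
    calc W t = W t * Real.exp (k * (t - T)) * Real.exp (k * (T - t)) := by
          rw [mul_assoc, ← Real.exp_add, ← mul_add]; simp
      _ ≤ _ := mul_le_mul_of_nonneg_right h2 (Real.exp_pos _).le
  · have h1 := hanti (Set.mem_Ici.2 le_rfl) ht ht
    exact h1.trans (le_mul_of_one_le_right (hW 0)
      (Real.one_le_exp (mul_nonneg hk (sub_nonneg.2 h))))

/-- G+D interlaced estimator convergence: under interval excitation of `ψ`, the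
estimate `θ̂` converges to `θ` globally exponentially, with all trajectories
bounded on `[0,∞)`. -/
theorem gd_estimator_convergence (n : ℕ) (hn : 1 ≤ n)
    (γg γ : ℝ) (hγg : 0 < γg) (hγ : 0 < γ)
    (θ θg0 θ0 : Fin n → ℝ)
    (ψ : ℝ → Fin n → ℝ) (hψ : Continuous ψ)
    (calY : ℝ → ℝ) (hcalY : ∀ t, calY t = ψ t ⬝ᵥ θ)
    (θg : ℝ → Fin n → ℝ)
    (hθg : ∀ t, HasDerivAt θg ((γg * (calY t - ψ t ⬝ᵥ θg t)) • ψ t) t)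
    (hθg0 : θg 0 = θg0)
    (Ω : ℝ → Matrix (Fin n) (Fin n) ℝ)
    (hΩ : ∀ t, ∀ i j, HasDerivAt (fun s => Ω s i j)
        ((((-γg) • vecMulVec (ψ t) (ψ t)) * Ω t) i j) t)
    (hΩ0 : Ω 0 = 1)
    (Δ : ℝ → ℝ) (hΔ : ∀ t, Δ t = ((1 : Matrix (Fin n) (Fin n) ℝ) - Ω t).det)
    (Y : ℝ → Fin n → ℝ)
    (hY : ∀ t, Y t = ((1 : Matrix (Fin n) (Fin n) ℝ) - Ω t).adjugate *ᵥ
        (θg t - Ω t *ᵥ θg0))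
    (θh : ℝ → Fin n → ℝ)
    (hθh : ∀ t, HasDerivAt θh ((γ * Δ t) • (Y t - Δ t • θh t)) t)
    (hθh0 : θh 0 = θ0)
    (td Cd : ℝ) (htd : 0 < td) (hCd : 0 < Cd)
    (hIE : ∀ v : Fin n → ℝ, Cd * (v ⬝ᵥ v) ≤ v ⬝ᵥ (obsGram n ψ td *ᵥ v)) :
    (∃ c > (0:ℝ), ∃ lam > (0:ℝ), ∀ t ≥ (0:ℝ),
        Real.sqrt ((θh t - θ) ⬝ᵥ (θh t - θ)) ≤ c * Real.exp (-lam * t)) ∧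
    (∃ M : ℝ, ∀ t ≥ (0:ℝ),
        Real.sqrt (θg t ⬝ᵥ θg t) ≤ M ∧
        Real.sqrt (θh t ⬝ᵥ θh t) ≤ M ∧
        ∀ i j, |Ω t i j| ≤ M) := by
  have hΩv : ∀ v : Fin n → ℝ, ∀ t, HasDerivAt (fun s => Ω s *ᵥ v)
      ((-γg * (ψ t ⬝ᵥ (Ω t *ᵥ v))) • ψ t) t := by
    intro v t
    have hvec : (-γg * (ψ t ⬝ᵥ (Ω t *ᵥ v))) • ψ t
        = (((-γg) • vecMulVec (ψ t) (ψ t)) * Ω t) *ᵥ v := by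
      rw [← mulVec_mulVec, smul_mulVec, vecMulVec_mulVec]
      ext i
      simp [mul_comm, mul_left_comm]
    rw [hvec]
    exact hasDerivAt_pi.2 fun i =>
      HasDerivAt.fun_sum (u := Finset.univ) fun j _ => (hΩ t i j).mul_const (v j)
  have hΩv0 : ∀ v : Fin n → ℝ, Ω 0 *ᵥ v = v := fun v => by rw [hΩ0, one_mulVec]
  have hΩanti : ∀ v : Fin n → ℝ, Antitone fun t => (Ω t *ᵥ v) ⬝ᵥ (Ω t *ᵥ v) := fun v =>
    antitone_dotProduct_self_of_gradient_flow hγg (hΩv v)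
  have herr : ∀ t, HasDerivAt (fun s => θg s - θ)
      ((-γg * (ψ t ⬝ᵥ (θg t - θ))) • ψ t) t := by
    intro t
    have h : -γg * (ψ t ⬝ᵥ (θg t - θ)) = γg * (calY t - ψ t ⬝ᵥ θg t) := by
      rw [hcalY, dotProduct_sub]
      ring
    rw [h]
    exact (hθg t).sub_const θ
  have hsol : ∀ t, 0 ≤ t → θg t - θ = Ω t *ᵥ (θg0 - θ) := by
    intro t ht
    have hz : ∀ t, HasDerivAt (fun s => (θg s - θ) - Ω s *ᵥ (θg0 - θ))
        ((-γg * (ψ t ⬝ᵥ ((θg t - θ) - Ω t *ᵥ (θg0 - θ)))) • ψ t) t := by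
      intro t
      rw [dotProduct_sub, mul_sub, sub_smul]
      exact (herr t).sub (hΩv (θg0 - θ) t)
    have h := antitone_dotProduct_self_of_gradient_flow hγg hz ht
    simp only [hΩv0, hθg0, sub_self, dotProduct_zero] at h
    exact sub_eq_zero.1 (dotProduct_self_eq_zero.1 (h.antisymm (dotProduct_self_nonneg_real _)))
  have hYΔ : ∀ t, 0 ≤ t → Y t = Δ t • θ := by
    intro t ht
    have h : θg t - Ω t *ᵥ θg0 = (1 - Ω t) *ᵥ θ := by
      have := hsol t ht
      rw [mulVec_sub, sub_eq_iff_eq_add] at this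
      rw [this, sub_mulVec, one_mulVec]
      abel
    rw [hY, h, mulVec_mulVec, adjugate_mul, smul_mulVec, one_mulVec, hΔ]
  obtain ⟨d, hd, hdet⟩ := exists_pos_le_det_one_sub_sq (Ω td) (by
    intro v hv
    have horth := dotProduct_eq_zero_of_gradient_flow (T := td) hγg (hΩv v)
      (by simpa only [hΩv0] using hv)
    simp only [hΩv0] at horth
    have h := hIE v
    rw [obsGram_mulVec_eq_zero hψ htd horth, dotProduct_zero] at h
    exact dotProduct_self_eq_zero.1 <| le_antisymm (nonpos_of_mul_nonpos_right h hCd)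
      (dotProduct_self_nonneg_real v))
  have hdecay : ∀ t, 0 ≤ t → (θh t - θ) ⬝ᵥ (θh t - θ)
      ≤ (θ0 - θ) ⬝ᵥ (θ0 - θ) * Real.exp (2 * γ * d * (td - t)) := by
    have := le_mul_exp_of_hasDerivAt (W := fun t => (θh t - θ) ⬝ᵥ (θh t - θ))
      (a := fun t => 2 * γ * Δ t ^ 2) (k := 2 * γ * d) htd.le (by positivity)
      (fun t => dotProduct_self_nonneg_real _) (fun t ht => by
        convert ((hθh t).sub_const θ).dotProduct_self using 1
        rw [hYΔ t ht, ← smul_sub, ← neg_sub (θh t) θ]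
        simp only [dotProduct_smul, dotProduct_neg, smul_eq_mul]
        ring) (fun t => by positivity) (fun t ht => by
        rw [hΔ]
        exact mul_le_mul_of_nonneg_left (hdet _ fun v => hΩanti v ht) (by positivity))
    simpa only [hθh0] using this
  set E := (θ0 - θ) ⬝ᵥ (θ0 - θ)
  have hE : 0 ≤ E := dotProduct_self_nonneg_real _
  refine ⟨⟨√(E * Real.exp (2 * γ * d * td)) + 1, by positivity, γ * d, by positivity,
    fun t ht => ?_⟩, ?_⟩
  · calc √((θh t - θ) ⬝ᵥ (θh t - θ))
        ≤ √(E * Real.exp (2 * γ * d * td) * Real.exp (-(γ * d) * t) ^ 2) := by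
          refine Real.sqrt_le_sqrt ((hdecay t ht).trans_eq ?_)
          rw [← Real.exp_nat_mul, mul_assoc E, ← Real.exp_add]
          congr 2
          push_cast
          ring
      _ = √(E * Real.exp (2 * γ * d * td)) * Real.exp (-(γ * d) * t) := by
          rw [Real.sqrt_mul (by positivity), Real.sqrt_sq (Real.exp_pos _).le]
      _ ≤ _ := mul_le_mul_of_nonneg_right (by linarith) (Real.exp_pos _).le
  · set Mg := √(2 * ((θg0 - θ) ⬝ᵥ (θg0 - θ)) + 2 * (θ ⬝ᵥ θ))
    set Mh := √(2 * (E * Real.exp (2 * γ * d * td)) + 2 * (θ ⬝ᵥ θ))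
    have hMg : 0 ≤ Mg := Real.sqrt_nonneg _
    have hMh : 0 ≤ Mh := Real.sqrt_nonneg _
    refine ⟨Mg + Mh + 1, fun t ht => ⟨?_, ?_, fun i j => ?_⟩⟩
    · have h := antitone_dotProduct_self_of_gradient_flow hγg herr ht
      simp only [hθg0] at h
      have : √(θg t ⬝ᵥ θg t) ≤ Mg :=
        Real.sqrt_le_sqrt ((dotProduct_self_le_of_sub (θg t) θ).trans (by linarith))
      linarith
    · have hexp : Real.exp (2 * γ * d * (td - t)) ≤ Real.exp (2 * γ * d * td) :=
        Real.exp_le_exp.2 (mul_le_mul_of_nonneg_left (by linarith) (by positivity))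
      have h := (hdecay t ht).trans (mul_le_mul_of_nonneg_left hexp hE)
      have : √(θh t ⬝ᵥ θh t) ≤ Mh :=
        Real.sqrt_le_sqrt ((dotProduct_self_le_of_sub (θh t) θ).trans (by linarith))
      linarith
    · have h := (sq_apply_le_of_mulVec_single (Ω t) i j).trans (hΩanti (Pi.single j 1) ht)
      simp only [hΩv0, single_dotProduct, Pi.single_eq_same, mul_one] at h
      have := (sq_le_one_iff_abs_le_one _).1 h
      linarith
end
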